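/- arXiv:2206.02741 — 6 statements merged into one kernel-verified Lean document; each statement's English description precedes it below -/
import Mathlib

section
/- For S ⊆ V let N_S := |{x ∈ 𝔽₂^E : x_v ∈ C for all v ∈ S}| and let k := dim T(C,G). Then for every real δ ≥ 0, Σ_{S ⊆ V} (1+2δ)^{|S|} · δ^{2(n−|S|)} · N_S ≤ 2^k · (1 + 2δ + δ²·2^{d−k₀})^n. (This inequality is the combinatorial content of the bound Z ≤ 2^k(1+2δ+δ²2^{d−k₀})^n on the normalization of the perturbed tensor-network state.) -/
/-- The Tanner code with local checks imposed only at the vertices in `S` (see context):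
functions `x : Sym2 V → ZMod 2` vanishing off the edge set of `G` whose local view at
every `v ∈ S` lies in `C`.  The full Tanner code `T(C,G)` is obtained for
`S = Finset.univ`. -/
noncomputable def tannerCodeOn {V : Type} [Fintype V] [DecidableEq V]
    (G : SimpleGraph V) (d : ℕ) (C : Submodule (ZMod 2) (Fin d → ZMod 2))
    (ν : V → Fin d → Sym2 V) (S : Finset V) :
    Submodule (ZMod 2) (Sym2 V → ZMod 2) :=
  (⨅ e ∈ {e : Sym2 V | e ∉ G.edgeSet},
      LinearMap.ker (LinearMap.proj (R := ZMod 2) (φ := fun _ : Sym2 V => ZMod 2) e)) ⊓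
    ⨅ v ∈ S, C.comap (LinearMap.funLeft (ZMod 2) (ZMod 2) (ν v))

theorem Submodule.finrank_le_finrank_inf_comap_add {K M N : Type*} [Field K]
    [AddCommGroup M] [Module K M] [FiniteDimensional K M]
    [AddCommGroup N] [Module K N] [FiniteDimensional K N]
    (W : Submodule K M) (C : Submodule K N) (f : M →ₗ[K] N) :
    Module.finrank K W ≤
      Module.finrank K (W ⊓ C.comap f : Submodule K M) +
        (Module.finrank K N - Module.finrank K C) := by
  let g : W →ₗ[K] N ⧸ C := C.mkQ ∘ₗ f ∘ₗ W.subtype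
  have hker : (LinearMap.ker g).map W.subtype = W ⊓ C.comap f := by
    ext x
    simp [g, and_comm]
  have hfin := Submodule.finrank_map_subtype_eq W (LinearMap.ker g)
  rw [hker] at hfin
  have hrank := g.finrank_range_add_finrank_ker
  have hrange := (LinearMap.range g).finrank_le
  have hquot := C.finrank_quotient_add_finrank
  omega

theorem tannerCodeOn_insert {V : Type} [Fintype V] [DecidableEq V]
    (G : SimpleGraph V) (d : ℕ) (C : Submodule (ZMod 2) (Fin d → ZMod 2))
    (ν : V → Fin d → Sym2 V) (v : V) (S : Finset V) :
    tannerCodeOn G d C ν (insert v S) =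
      tannerCodeOn G d C ν S ⊓ C.comap (LinearMap.funLeft (ZMod 2) (ZMod 2) (ν v)) := by
  simp only [tannerCodeOn, Finset.iInf_insert]
  rw [inf_assoc, inf_comm (C.comap _)]

theorem finrank_tannerCodeOn_le_union {V : Type} [Fintype V] [DecidableEq V]
    (G : SimpleGraph V) (d : ℕ) (C : Submodule (ZMod 2) (Fin d → ZMod 2))
    (ν : V → Fin d → Sym2 V) (S R : Finset V) :
    Module.finrank (ZMod 2) (tannerCodeOn G d C ν S) ≤
      Module.finrank (ZMod 2) (tannerCodeOn G d C ν (R ∪ S)) +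
        (d - Module.finrank (ZMod 2) C) * R.card := by
  induction R using Finset.induction_on with
  | empty => rw [Finset.empty_union]; omega
  | insert v R hv ih =>
    have h := (tannerCodeOn G d C ν (R ∪ S)).finrank_le_finrank_inf_comap_add C
      (LinearMap.funLeft (ZMod 2) (ZMod 2) (ν v))
    rw [← tannerCodeOn_insert, Module.finrank_fin_fun] at h
    rw [Finset.insert_union, Finset.card_insert_of_notMem hv, mul_add_one]
    omega

theorem natCard_tannerCodeOn_le {V : Type} [Fintype V] [DecidableEq V]
    (G : SimpleGraph V) (d : ℕ) (C : Submodule (ZMod 2) (Fin d → ZMod 2))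
    (ν : V → Fin d → Sym2 V) (S : Finset V) :
    Nat.card (tannerCodeOn G d C ν S) ≤
      2 ^ Module.finrank (ZMod 2) (tannerCodeOn G d C ν Finset.univ) *
        (2 ^ (d - Module.finrank (ZMod 2) C)) ^ (Fintype.card V - S.card) := by
  have h := finrank_tannerCodeOn_le_union G d C ν S Sᶜ
  rw [Finset.union_comm, Finset.union_compl, Finset.card_compl] at h
  rw [Module.natCard_eq_pow_finrank (K := ZMod 2), Nat.card_zmod, ← pow_mul, ← pow_add]
  exact Nat.pow_le_pow_right two_pos h

/-- with `N_S` the number of `x ∈ 𝔽₂^E` satisfying the local checks at every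
vertex of `S`, and `k = dim T(C,G)`, for every `δ ≥ 0` one has
`∑_{S ⊆ V} (1+2δ)^{|S|} δ^{2(n-|S|)} N_S ≤ 2^k (1 + 2δ + δ² 2^{d-k₀})^n`. -/
theorem tanner_partition_function_upper_bound {V : Type} [Fintype V] [DecidableEq V]
    (G : SimpleGraph V) [DecidableRel G.Adj]
    (d n k₀ : ℕ)
    (hn : Fintype.card V = n)
    (hreg : G.IsRegularOfDegree d)
    (C : Submodule (ZMod 2) (Fin d → ZMod 2))
    (hk₀ : Module.finrank (ZMod 2) C = k₀)
    (ν : V → Fin d → Sym2 V)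
    (hν : ∀ v : V, Set.range (ν v) = G.incidenceSet v ∧ Function.Injective (ν v))
    (δ : ℝ) (hδ : 0 ≤ δ) :
    ∑ S ∈ (Finset.univ : Finset V).powerset,
        (1 + 2 * δ) ^ S.card * δ ^ (2 * (n - S.card))
          * (Nat.card (tannerCodeOn G d C ν S) : ℝ)
      ≤ 2 ^ (Module.finrank (ZMod 2) (tannerCodeOn G d C ν Finset.univ))
          * (1 + 2 * δ + δ ^ 2 * 2 ^ (d - k₀)) ^ n := by
  subst hn hk₀
  rw [← Finset.card_univ (α := V), ← Finset.sum_pow_mul_eq_add_pow, Finset.mul_sum]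
  refine Finset.sum_le_sum fun S _ => ?_
  have h : (Nat.card (tannerCodeOn G d C ν S) : ℝ) ≤
      2 ^ Module.finrank (ZMod 2) (tannerCodeOn G d C ν Finset.univ) *
        (2 ^ (d - Module.finrank (ZMod 2) C)) ^ ((Finset.univ : Finset V).card - S.card) := by
    exact_mod_cast natCard_tannerCodeOn_le G d C ν S
  refine (mul_le_mul_of_nonneg_left h (by positivity)).trans_eq ?_
  rw [mul_pow (δ ^ 2), ← pow_mul δ]
  ring
end

section
/- Suppose ε ≤ 1/(6d), G satisfies λ-mixing, the minimum distance Δ₀ of C satisfies Δ₀ ≥ 4λ, and W ⊆ V satisfies |W| ≤ 2ε|E|. Then every nonzero codeword x ∈ T′ has Hamming weight either at most 8d²ε·|E′ ∪ F| or at least (Δ₀²/(8d²))·|E′ ∪ F|. Consequently, since T′ is linear, the Hamming distance between any two codewords of T′ is either ≤ 8d²ε|E′ ∪ F| or ≥ (Δ₀²/(8d²))|E′ ∪ F|. -/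
namespace SimpleGraph

variable {V : Type*}

/-- The graph of nonzero entries of an edge labelling supported on the edges of `G`. -/
def labelSupport {R : Type*} [Zero R] (G : SimpleGraph V) (x : Sym2 V → R)
    (hx : ∀ e, e ∉ G.edgeSet → x e = 0) : SimpleGraph V where
  Adj u v := x s(u, v) ≠ 0
  symm := ⟨fun u v h => by rwa [Sym2.eq_swap]⟩
  loopless := ⟨fun v h => h (hx _ (by simp))⟩

section labelSupport

variable {R : Type*} [Zero R] (G : SimpleGraph V) (x : Sym2 V → R)
  (hx : ∀ e, e ∉ G.edgeSet → x e = 0)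

lemma mem_edgeSet_labelSupport {e : Sym2 V} : e ∈ (G.labelSupport x hx).edgeSet ↔ x e ≠ 0 := by
  induction e with
  | h a b => rfl

lemma labelSupport_le : G.labelSupport x hx ≤ G := fun u v h => by
  by_contra hG
  exact h (hx _ hG)

variable [Fintype V]

lemma card_edgeFinset_labelSupport [DecidableEq R] [DecidableRel (G.labelSupport x hx).Adj] :
    (G.labelSupport x hx).edgeFinset.card = hammingNorm x := by
  unfold hammingNorm
  congr 1
  ext e
  simp [mem_edgeFinset, mem_edgeSet_labelSupport]

variable [DecidableEq V]

/-- The weight of the local view at `v` is the degree of `v` in the support graph. -/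
lemma hammingNorm_local_view [DecidableEq R] [DecidableRel (G.labelSupport x hx).Adj] {d : ℕ}
    (v : V) (f : Fin d → Sym2 V) (hf : Set.range f = G.incidenceSet v)
    (hinj : Function.Injective f) :
    hammingNorm (fun i => x (f i)) = (G.labelSupport x hx).degree v := by
  rw [← card_incidenceFinset_eq_degree, hammingNorm, ← Finset.card_image_of_injective _ hinj]
  congr 1
  ext e
  simp only [Finset.mem_image, Finset.mem_filter, Finset.mem_univ, true_and, mem_incidenceFinset]
  constructor
  · rintro ⟨i, hi, rfl⟩
    have : f i ∈ G.incidenceSet v := hf ▸ Set.mem_range_self i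
    exact ⟨(G.mem_edgeSet_labelSupport x hx).2 hi, this.2⟩
  · rintro ⟨he, hv⟩
    have : e ∈ Set.range f := hf ▸ ⟨edgeSet_mono (G.labelSupport_le x hx) he, hv⟩
    obtain ⟨i, rfl⟩ := this
    exact ⟨i, (G.mem_edgeSet_labelSupport x hx).1 he, rfl⟩

end labelSupport

variable [Fintype V] [DecidableEq V]

/-- A vertex set meeting every edge of `H ≤ G`, with `G` regular, bounds the number of edges. -/
lemma card_edgeFinset_le_of_cover (G H : SimpleGraph V) [DecidableRel G.Adj]
    [DecidableRel H.Adj] {d : ℕ} (hreg : G.IsRegularOfDegree d) (hle : H ≤ G) (A : Finset V)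
    (hA : ∀ e ∈ H.edgeSet, ∃ v ∈ e, v ∈ A) :
    H.edgeFinset.card ≤ d * A.card := by
  have hsub : H.edgeFinset ⊆ A.biUnion fun v => G.incidenceFinset v := by
    intro e he
    rw [mem_edgeFinset] at he
    obtain ⟨v, hv, hvA⟩ := hA e he
    exact Finset.mem_biUnion.2 ⟨v, hvA, by
      rw [mem_incidenceFinset]; exact ⟨edgeSet_mono hle he, hv⟩⟩
  calc H.edgeFinset.card ≤ _ := Finset.card_le_card hsub
    _ ≤ A.card * d := Finset.card_biUnion_le_card_mul _ _ _ fun v _ => by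
        rw [card_incidenceFinset_eq_degree, hreg.degree_eq]
    _ = d * A.card := mul_comm _ _

/-- In a `d`-regular graph, all but at most `d * #W` edges have an endpoint outside `W`. -/
lemma card_edgeFinset_le_card_edges_touching_compl_add (G : SimpleGraph V) [DecidableRel G.Adj]
    {d : ℕ} (hreg : G.IsRegularOfDegree d) (W : Finset V) :
    G.edgeFinset.card ≤ (G.edgeFinset.filter fun e => ∃ v ∈ e, v ∉ W).card + d * W.card := by
  rw [← Finset.card_filter_add_card_filter_not (s := G.edgeFinset) (fun e => ∃ v ∈ e, v ∉ W)]
  gcongr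
  have hsub : (G.edgeFinset.filter fun e => ¬ ∃ v ∈ e, v ∉ W) ⊆
      W.biUnion fun v => G.incidenceFinset v := by
    intro e he
    rw [Finset.mem_filter, mem_edgeFinset] at he
    obtain ⟨he, hW⟩ := he
    push Not at hW
    induction e with
    | h a b =>
      exact Finset.mem_biUnion.2 ⟨a, hW a (Sym2.mem_mk_left a b), by
        rw [mem_incidenceFinset]; exact ⟨he, Sym2.mem_mk_left a b⟩⟩
  calc _ ≤ _ := Finset.card_le_card hsub
    _ ≤ W.card * d := Finset.card_biUnion_le_card_mul _ _ _ fun v _ => by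
        rw [card_incidenceFinset_eq_degree, hreg.degree_eq]
    _ = d * W.card := mul_comm _ _

/-- Degrees in `H ≤ G` summed over `A`, when all `H`-neighbours of `A` lie in `A ∪ W`. -/
lemma sum_degree_le_of_neighbors_subset (G H : SimpleGraph V) [DecidableRel G.Adj]
    [DecidableRel H.Adj] {d : ℕ} (hreg : G.IsRegularOfDegree d) (hle : H ≤ G) (A W : Finset V)
    (hAW : ∀ v ∈ A, ∀ u, H.Adj v u → u ∈ A ∨ u ∈ W) :
    ∑ v ∈ A, H.degree v ≤ ∑ v ∈ A, (A ∩ G.neighborFinset v).card + d * W.card := by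
  have hdeg : ∀ v ∈ A, H.degree v ≤
      (A ∩ G.neighborFinset v).card + (W.filter fun u => G.Adj v u).card := by
    intro v hv
    rw [← card_neighborFinset_eq_degree]
    refine (Finset.card_le_card ?_).trans (Finset.card_union_le _ _)
    intro u hu
    rw [mem_neighborFinset] at hu
    have hG := hle hu
    rcases hAW v hv u hu with h | h <;> simp [h, hG]
  have hswap : ∑ v ∈ A, (W.filter fun u => G.Adj v u).card
      = ∑ u ∈ W, (A.filter fun v => G.Adj v u).card :=
    Finset.sum_card_bipartiteAbove_eq_sum_card_bipartiteBelow G.Adj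
  have hW : ∑ u ∈ W, (A.filter fun v => G.Adj v u).card ≤ W.card * d := by
    refine Finset.sum_le_card_nsmul _ _ _ fun u _ => ?_
    rw [← hreg.degree_eq u, ← card_neighborFinset_eq_degree]
    refine Finset.card_le_card fun v hv => ?_
    rw [mem_neighborFinset]
    exact (Finset.mem_filter.1 hv).2.symm
  calc _ ≤ _ := Finset.sum_le_sum hdeg
    _ = ∑ v ∈ A, (A ∩ G.neighborFinset v).card
          + ∑ v ∈ A, (W.filter fun u => G.Adj v u).card := Finset.sum_add_distrib
    _ ≤ _ := by rw [hswap, mul_comm d]; gcongr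

end SimpleGraph

/-- The counting estimates for a partially violated Tanner code force its weight dichotomy. -/
lemma weight_dichotomy_of_counting {d n D w a M E W lam ε : ℝ} (hd : 0 < d) (hn : 0 < n)
    (hD : 0 ≤ D) (ha : 0 ≤ a) (hw : 0 ≤ w) (hε0 : 0 ≤ ε) (hεd : ε ≤ 1 / (6 * d))
    (hΔ : 4 * lam ≤ D) (hE : 2 * E = n * d) (hW : W ≤ 2 * ε * E) (hME : M ≤ E)
    (hEM : E ≤ M + d * W) (hwa : w ≤ d * a) (hDa : D * a ≤ 2 * w) (hD1 : D = 0 ∨ 1 ≤ D)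
    (hmix : D * a ≤ d * a ^ 2 / n + lam * a + d * W) :
    w ≤ 8 * d ^ 2 * ε * M ∨ D ^ 2 / (8 * d ^ 2) * M ≤ w := by
  rcases hD1 with rfl | hD1
  · right; simpa using hw
  have hWn : W ≤ ε * (n * d) := by linarith [congrArg (ε * ·) hE]
  rcases le_total (D * n) (4 * d * a) with h | h
  · right
    have h1 : D * (D * n) ≤ D * (4 * d * a) := by gcongr
    have h2 : d * (D * a) ≤ d * (2 * w) := by gcongr
    have h3 : D ^ 2 * M ≤ D ^ 2 * (n * d / 2) := by
      have : M ≤ n * d / 2 := by linarith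
      gcongr
    rw [div_mul_eq_mul_div, div_le_iff₀ (by positivity)]
    have h4 : d * (D * (D * n)) ≤ d * (8 * d * w) :=
      mul_le_mul_of_nonneg_left (by linarith) hd.le
    have : 0 ≤ d ^ 2 * w := by positivity
    linarith
  · left
    have hq : d * a ^ 2 / n ≤ D * a / 4 := by
      rw [div_le_iff₀ hn]
      have := mul_le_mul_of_nonneg_left h ha
      linarith
    have hl : 4 * lam * a ≤ D * a := by gcongr
    have hdW : d * W ≤ d * (ε * (n * d)) := by gcongr
    have hDa' : D * a ≤ 2 * (d * (ε * (n * d))) := by linarith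
    have haD : a ≤ D * a := le_mul_of_one_le_left ha hD1
    have hw' : w ≤ d * (2 * (d * (ε * (n * d)))) := hwa.trans (by gcongr; linarith)
    have hεd' : ε * (6 * d) ≤ 1 := by rwa [le_div_iff₀ (by positivity)] at hεd
    have hM : n * d / 3 ≤ M := by
      have : ε * (6 * d) * (n * d) ≤ 1 * (n * d) := by gcongr
      linarith
    have h8 : 8 * d ^ 2 * ε * (n * d / 3) ≤ 8 * d ^ 2 * ε * M := by gcongr
    have : 0 ≤ d ^ 2 * ε * (n * d) := by positivity
    linarith


/-- if `ε ≤ 1/(6d)`, `G` satisfies `λ`-mixing, `Δ₀ ≥ 4λ`, and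
`|W| ≤ 2ε|E|`, then every nonzero codeword `x` of the punctured Tanner code `T′`
(checks only at the vertices `V′ = V ∖ W`, bits on the edges `E′ ∪ F` touching `V′`) has
Hamming weight either `≤ 8d²ε|E′ ∪ F|` or `≥ (Δ₀²/(8d²))|E′ ∪ F|`. -/
theorem punctured_tanner_weight_dichotomy {V : Type} [Fintype V] [DecidableEq V]
    (G : SimpleGraph V) [DecidableRel G.Adj]
    (d n k₀ Δ₀ : ℕ) (lam ε : ℝ) (hlam : 0 ≤ lam) (hε0 : 0 ≤ ε)
    (hn : Fintype.card V = n)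
    (hreg : G.IsRegularOfDegree d)
    (C : Submodule (ZMod 2) (Fin d → ZMod 2))
    (hk₀ : Module.finrank (ZMod 2) C = k₀)
    (hC : ∀ c ∈ C, c ≠ 0 → Δ₀ ≤ hammingNorm c)
    (hΔ : (Δ₀ : ℝ) ≥ 4 * lam)
    (ν : V → Fin d → Sym2 V)
    (hν : ∀ v : V, Set.range (ν v) = G.incidenceSet v ∧ Function.Injective (ν v))
    (hmix : ∀ S : Finset V,
      (∑ v ∈ S, (S ∩ G.neighborFinset v).card : ℝ)
        ≤ d * (S.card : ℝ) ^ 2 / n + lam * S.card)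
    (hεd : ε ≤ 1 / (6 * d))
    (W : Finset V)
    (hW : (W.card : ℝ) ≤ 2 * ε * G.edgeFinset.card)
    -- `x ∈ 𝔽₂^{E′ ∪ F}`, extended by zero: it vanishes on non-edges and on edges with
    -- both endpoints in `W`
    (x : Sym2 V → ZMod 2)
    (hx0 : ∀ e : Sym2 V, (e ∉ G.edgeSet ∨ ∀ v ∈ e, v ∈ W) → x e = 0)
    -- `x ∈ T′`: the local checks hold at every vertex of `V′ = V ∖ W`
    (hxT : ∀ v : V, v ∉ W → (fun i => x (ν v i)) ∈ C)
    (hxne : x ≠ 0) :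
    (hammingNorm x : ℝ)
        ≤ 8 * d ^ 2 * ε
            * Nat.card {e : Sym2 V // e ∈ G.edgeSet ∧ ∃ v ∈ e, v ∉ W}
      ∨ (hammingNorm x : ℝ)
        ≥ (Δ₀ : ℝ) ^ 2 / (8 * d ^ 2)
            * Nat.card {e : Sym2 V // e ∈ G.edgeSet ∧ ∃ v ∈ e, v ∉ W} := by
  classical
  have hxG : ∀ e, e ∉ G.edgeSet → x e = 0 := fun e he => hx0 e (Or.inl he)
  set H := G.labelSupport x hxG with hH
  have hle : H ≤ G := G.labelSupport_le x hxG
  have hcard : H.edgeFinset.card = hammingNorm x := G.card_edgeFinset_labelSupport x hxG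
  set A : Finset V := Finset.univ.filter fun v => v ∉ W ∧ H.degree v ≠ 0 with hA
  have hmemA : ∀ v u, v ∉ W → H.Adj v u → v ∈ A := fun v u hv h => by
    simp only [hA, Finset.mem_filter, Finset.mem_univ, true_and]
    exact ⟨hv, ((H.degree_pos_iff_exists_adj v).2 ⟨u, h⟩).ne'⟩
  have hdegA : ∀ v ∈ A, Δ₀ ≤ H.degree v := fun v hv => by
    simp only [hA, Finset.mem_filter, Finset.mem_univ, true_and] at hv
    have hloc := G.hammingNorm_local_view x hxG v (ν v) (hν v).1 (hν v).2
    rw [← hH] at hloc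
    rw [← hloc]
    refine hC _ (hxT v hv.1) fun h0 => hv.2 ?_
    rw [← hloc, h0, hammingNorm_zero]
  have hcover : ∀ e ∈ H.edgeSet, ∃ v ∈ e, v ∈ A := by
    intro e he
    have hne := (G.mem_edgeSet_labelSupport x hxG).1 he
    obtain ⟨v, hve, hvW⟩ : ∃ v ∈ e, v ∉ W := by
      by_contra! hcon
      exact hne (hx0 e (Or.inr hcon))
    obtain ⟨u, rfl⟩ := Sym2.mem_iff_exists.1 hve
    exact ⟨v, hve, hmemA v u hvW he⟩
  have hwa := SimpleGraph.card_edgeFinset_le_of_cover G H hreg hle A hcover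
  have hsum := SimpleGraph.sum_degree_le_of_neighbors_subset G H hreg hle A W
    fun v _ u huv => by
      by_cases hu : u ∈ W
      · exact Or.inr hu
      · exact Or.inl (hmemA u v hu huv.symm)
  have hDa : A.card * Δ₀ ≤ ∑ v ∈ A, H.degree v := Finset.card_nsmul_le_sum _ _ _ hdegA
  have hsum2 : ∑ v ∈ A, H.degree v ≤ 2 * H.edgeFinset.card := by
    rw [← H.sum_degrees_eq_twice_card_edges]
    exact Finset.sum_le_univ_sum_of_nonneg fun _ => Nat.zero_le _
  have hE : 2 * G.edgeFinset.card = n * d := by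
    rw [← G.sum_degrees_eq_twice_card_edges, ← hn]
    simp [hreg.degree_eq]
  have hM : Nat.card {e : Sym2 V // e ∈ G.edgeSet ∧ ∃ v ∈ e, v ∉ W} =
      (G.edgeFinset.filter fun e => ∃ v ∈ e, v ∉ W).card := by
    rw [Nat.card_eq_fintype_card, Fintype.card_subtype]
    congr 1
    ext e
    simp
  have hEM := G.card_edgeFinset_le_card_edges_touching_compl_add hreg W
  have hME : (G.edgeFinset.filter fun e => ∃ v ∈ e, v ∉ W).card ≤ G.edgeFinset.card :=
    Finset.card_filter_le _ _
  have hnd : 0 < n * d := by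
    rw [← hE]
    obtain ⟨e, he⟩ := Function.ne_iff.1 hxne
    have : 0 < G.edgeFinset.card := Finset.card_pos.2 ⟨e, by
      rw [SimpleGraph.mem_edgeFinset]
      by_contra h
      exact he (hxG e h)⟩
    omega
  rw [hcard] at hwa hsum2
  rw [hM]
  have hDmix : (Δ₀ : ℝ) * A.card ≤
      d * (A.card : ℝ) ^ 2 / n + lam * A.card + d * W.card := by
    have h1 : (A.card : ℝ) * Δ₀ ≤
        ∑ v ∈ A, ((A ∩ G.neighborFinset v).card : ℝ) + d * W.card := by
      exact_mod_cast hDa.trans hsum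
    linarith [hmix A]
  refine weight_dichotomy_of_counting (n := n) (a := A.card) (E := G.edgeFinset.card)
    (W := W.card) (lam := lam) (by exact_mod_cast Nat.pos_of_mul_pos_left hnd)
    (by exact_mod_cast Nat.pos_of_mul_pos_right hnd) (by positivity) (by positivity)
    (by positivity) hε0 hεd hΔ (by exact_mod_cast hE) hW (by exact_mod_cast hME)
    (by exact_mod_cast hEM) (by exact_mod_cast hwa) ?_ ?_ hDmix
  · rw [mul_comm]
    exact_mod_cast hDa.trans hsum2
  · rcases Nat.eq_zero_or_pos Δ₀ with h | h
    · exact Or.inl (by exact_mod_cast h)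
    · exact Or.inr (by exact_mod_cast h)
end

section
/- Suppose ε ≤ 1/(6d), G satisfies λ-mixing, the minimum distance Δ₀ of C satisfies Δ₀ ≥ 4λ, and W ⊆ V satisfies |W| ≤ 2ε|E|. Let x ∈ T′ be a nonzero codeword with Hamming weight at least 4d²ε|E|, and let S ⊆ V′ be the set of vertices of V′ incident to at least one edge e ∈ E′ ∪ F with x_e = 1. Then |S| ≥ nΔ₀/(4d). -/
/-- Each row of the word `x` at a vertex `v ∉ W` is supported on edges to `S` or to `W`. -/
lemma hammingNorm_row_le_card_inter {V : Type} [Fintype V] [DecidableEq V]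
    (G : SimpleGraph V) [DecidableRel G.Adj] {d : ℕ} (ν : V → Fin d → Sym2 V)
    (hν : ∀ v : V, Set.range (ν v) = G.incidenceSet v ∧ Function.Injective (ν v))
    (W S : Finset V) (x : Sym2 V → ZMod 2)
    (hS : ∀ u v : V, G.Adj v u → u ∉ W → x s(v, u) ≠ 0 → u ∈ S) (v : V) :
    hammingNorm (fun i => x (ν v i))
      ≤ (S ∩ G.neighborFinset v).card + (W ∩ G.neighborFinset v).card := by
  have hsub : (Finset.univ.filter fun i => x (ν v i) ≠ 0).image (ν v)
      ⊆ ((S ∩ G.neighborFinset v) ∪ (W ∩ G.neighborFinset v)).image fun u => s(v, u) := by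
    intro e he
    obtain ⟨i, hi, rfl⟩ := Finset.mem_image.1 he
    have hi' : x (ν v i) ≠ 0 := (Finset.mem_filter.1 hi).2
    have hinc : ν v i ∈ G.incidenceSet v := (hν v).1 ▸ Set.mem_range_self i
    obtain ⟨u, hu⟩ := Sym2.mem_iff_exists.1 hinc.2
    have hadj : G.Adj v u := by simpa [hu] using hinc.1
    refine Finset.mem_image.2 ⟨u, ?_, hu.symm⟩
    by_cases huW : u ∈ W
    · simp [huW, hadj]
    · simp [hS u v hadj huW (hu ▸ hi'), hadj]
  calc hammingNorm (fun i => x (ν v i))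
      = ((Finset.univ.filter fun i => x (ν v i) ≠ 0).image (ν v)).card := by
        rw [Finset.card_image_of_injective _ (hν v).2]; rfl
    _ ≤ _ := Finset.card_le_card hsub
    _ ≤ _ := Finset.card_image_le
    _ ≤ _ := Finset.card_union_le _ _

/-- In a `d`-regular graph at most `d * |W|` edges run between `S` and `W`. -/
lemma sum_card_inter_neighborFinset_le {V : Type} [Fintype V] [DecidableEq V]
    (G : SimpleGraph V) [DecidableRel G.Adj] {d : ℕ} (hreg : G.IsRegularOfDegree d)
    (S W : Finset V) :
    ∑ v ∈ S, (W ∩ G.neighborFinset v).card ≤ W.card * d := by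
  have hswap : ∑ v ∈ S, (W ∩ G.neighborFinset v).card
      = ∑ w ∈ W, (S ∩ G.neighborFinset w).card := by
    have h := Finset.sum_card_bipartiteAbove_eq_sum_card_bipartiteBelow (s := S) (t := W) G.Adj
    convert h using 3 with v _ w _
    · ext u; simp [Finset.bipartiteAbove]
    · ext u; simp [Finset.bipartiteBelow, G.adj_comm]
  rw [hswap]
  refine Finset.sum_le_card_nsmul _ _ _ fun w _ => ?_
  calc _ ≤ (G.neighborFinset w).card := Finset.card_le_card Finset.inter_subset_right
    _ = d := by rw [G.card_neighborFinset_eq_degree, hreg w]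

/-- A word all of whose support edges touch `S` has weight at most `d * |S|`. -/
lemma hammingNorm_le_card_mul_degree {V : Type} [Fintype V] [DecidableEq V]
    (G : SimpleGraph V) [DecidableRel G.Adj] {d : ℕ} (hreg : G.IsRegularOfDegree d)
    (S : Finset V) (x : Sym2 V → ZMod 2)
    (hx : ∀ e, x e ≠ 0 → ∃ v ∈ S, e ∈ G.incidenceSet v) :
    hammingNorm x ≤ S.card * d := by
  refine (Finset.card_le_card (t := S.biUnion fun v => G.incidenceFinset v) ?_).trans
    (Finset.card_biUnion_le_card_mul _ _ _ fun v _ => ?_)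
  · intro e he
    obtain ⟨v, hv, hev⟩ := hx e (Finset.mem_filter.1 he).2
    exact Finset.mem_biUnion.2 ⟨v, hv, by simpa using hev⟩
  · rw [G.card_incidenceFinset_eq_degree, hreg v]

/-- under the hypotheses of the punctured-code dichotomy, if the nonzero
codeword `x ∈ T′` has Hamming weight at least `4d²ε|E|`, then the set `S ⊆ V′` of
vertices of `V′` incident to at least one edge of `E′ ∪ F` carrying a `1` satisfies
`|S| ≥ n Δ₀/(4d)`. -/
theorem punctured_tanner_support_vertices_lower_bound {V : Type} [Fintype V] [DecidableEq V]
    (G : SimpleGraph V) [DecidableRel G.Adj]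
    (d n k₀ Δ₀ : ℕ) (lam ε : ℝ) (hlam : 0 ≤ lam) (hε0 : 0 ≤ ε)
    (hn : Fintype.card V = n)
    (hreg : G.IsRegularOfDegree d)
    (C : Submodule (ZMod 2) (Fin d → ZMod 2))
    (hk₀ : Module.finrank (ZMod 2) C = k₀)
    (hC : ∀ c ∈ C, c ≠ 0 → Δ₀ ≤ hammingNorm c)
    (hΔ : (Δ₀ : ℝ) ≥ 4 * lam)
    (ν : V → Fin d → Sym2 V)
    (hν : ∀ v : V, Set.range (ν v) = G.incidenceSet v ∧ Function.Injective (ν v))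
    (hmix : ∀ S : Finset V,
      (∑ v ∈ S, (S ∩ G.neighborFinset v).card : ℝ)
        ≤ d * (S.card : ℝ) ^ 2 / n + lam * S.card)
    (hεd : ε ≤ 1 / (6 * d))
    (W : Finset V)
    (hW : (W.card : ℝ) ≤ 2 * ε * G.edgeFinset.card)
    (x : Sym2 V → ZMod 2)
    (hx0 : ∀ e : Sym2 V, (e ∉ G.edgeSet ∨ ∀ v ∈ e, v ∈ W) → x e = 0)
    (hxT : ∀ v : V, v ∉ W → (fun i => x (ν v i)) ∈ C)
    (hxne : x ≠ 0)
    (hwt : (hammingNorm x : ℝ) ≥ 4 * d ^ 2 * ε * G.edgeFinset.card)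
    (S : Finset V)
    (hS : ∀ v : V, v ∈ S ↔ v ∉ W ∧ ∃ i : Fin d, x (ν v i) = 1) :
    (S.card : ℝ) ≥ n * Δ₀ / (4 * d) := by
  have hone : ∀ a : ZMod 2, a ≠ 0 → a = 1 := by decide
  have hmemS : ∀ v e, v ∉ W → e ∈ G.incidenceSet v → x e ≠ 0 → v ∈ S := by
    intro v e hv he hxe
    obtain ⟨i, rfl⟩ := (hν v).1.symm ▸ he
    exact (hS v).2 ⟨hv, i, hone _ hxe⟩
  have hcover : ∀ e, x e ≠ 0 → ∃ v ∈ S, e ∈ G.incidenceSet v := by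
    intro e hxe
    have h := mt (hx0 e) hxe
    push Not at h
    obtain ⟨he, v, hve, hv⟩ := h
    exact ⟨v, hmemS v e hv ⟨he, hve⟩ hxe, he, hve⟩
  obtain ⟨e₀, he₀⟩ := Function.ne_iff.1 hxne
  obtain ⟨v₀, hv₀, he₀v₀⟩ := hcover e₀ he₀
  have hd : 0 < d := by
    obtain ⟨i, -⟩ := (hν v₀).1.symm ▸ he₀v₀
    exact i.pos
  have hnpos : 0 < n := hn ▸ Fintype.card_pos_iff.2 ⟨v₀⟩
  have hSpos : 0 < S.card := Finset.card_pos.2 ⟨v₀, hv₀⟩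
  rcases Nat.eq_zero_or_pos Δ₀ with rfl | hΔpos
  · simp
  have hcount : S.card * Δ₀
      ≤ ∑ v ∈ S, (S ∩ G.neighborFinset v).card + W.card * d := by
    calc S.card * Δ₀ ≤ ∑ v ∈ S, hammingNorm (fun i => x (ν v i)) := by
          refine Finset.card_nsmul_le_sum _ _ _ fun v hv => ?_
          obtain ⟨hvW, i, hi⟩ := (hS v).1 hv
          refine hC _ (hxT v hvW) fun h => ?_
          have h0 : x (ν v i) = 0 := congrFun h i
          rw [hi] at h0
          exact one_ne_zero h0
      _ ≤ ∑ v ∈ S, ((S ∩ G.neighborFinset v).card + (W ∩ G.neighborFinset v).card) :=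
          Finset.sum_le_sum fun v _ => hammingNorm_row_le_card_inter G ν hν W S x
            (fun u v huv hu hxe => hmemS u _ hu ⟨huv, Sym2.mem_mk_right v u⟩ hxe) v
      _ ≤ _ := by
          rw [Finset.sum_add_distrib]
          exact Nat.add_le_add_left (sum_card_inter_neighborFinset_le G hreg S W) _
  have hweight : (hammingNorm x : ℝ) ≤ S.card * d := by
    exact_mod_cast hammingNorm_le_card_mul_degree G hreg S x hcover
  have hcount' : (S.card : ℝ) * Δ₀
      ≤ (∑ v ∈ S, (S ∩ G.neighborFinset v).card : ℝ) + W.card * d := by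
    exact_mod_cast hcount
  have hmixS := hmix S
  have hd' : (0 : ℝ) < d := by exact_mod_cast hd
  have hn' : (0 : ℝ) < n := by exact_mod_cast hnpos
  have hs : (0 : ℝ) < S.card := by exact_mod_cast hSpos
  have hΔ1 : (1 : ℝ) ≤ Δ₀ := by exact_mod_cast hΔpos
  have hsize : 4 * d * ε * G.edgeFinset.card ≤ (S.card : ℝ) := by
    refine le_of_mul_le_mul_right ?_ hd'
    linarith
  have hWd : (W.card : ℝ) * d ≤ S.card / 2 := by
    have := mul_le_mul_of_nonneg_right hW hd'.le
    linarith
  have hratio : (Δ₀ : ℝ) ≤ d * S.card / n + lam + 1 / 2 := by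
    refine le_of_mul_le_mul_left ?_ hs
    calc (S.card : ℝ) * Δ₀ ≤ d * (S.card : ℝ) ^ 2 / n + lam * S.card + S.card / 2 := by linarith
      _ = _ := by ring
  have hquarter : (Δ₀ : ℝ) / 4 ≤ d * S.card / n := by linarith
  rw [le_div_iff₀ hn'] at hquarter
  rw [ge_iff_le, div_le_iff₀ (by positivity)]
  linarith
end

section
/- Suppose ε := |E_del|/|E| satisfies ε ≤ Δ₀²/(300d⁴), G satisfies λ-mixing, and the minimum distance Δ₀ of C satisfies Δ₀ ≥ 4λ. Then for any two elements y, z ∈ X, the Hamming distance between y and z (as strings indexed by E₁ ∪ R) is either at most 10d²ε·(|E₁| + |R|) or at least (Δ₀²/(10d²))·(|E₁| + |R|). -/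
/-- Double counting of the incidences between the vertices and a set of edges. -/
lemma SimpleGraph.sum_card_filter_mem_eq_two_mul {V : Type*} [Fintype V] [DecidableEq V]
    (G : SimpleGraph V) [DecidableRel G.Adj] {F : Finset (Sym2 V)} (hF : F ⊆ G.edgeFinset) :
    ∑ v : V, (F.filter (fun e => v ∈ e)).card = 2 * F.card := by
  classical
  have hswap : ∑ v : V, (F.filter (fun e => v ∈ e)).card
      = ∑ e ∈ F, (Finset.univ.filter (fun v : V => v ∈ e)).card := by
    simp only [Finset.card_filter]
    exact Finset.sum_comm
  rw [hswap, Finset.sum_congr rfl (g := fun _ => 2), Finset.sum_const, smul_eq_mul, mul_comm]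
  intro e he
  have hd : ¬ e.IsDiag := G.not_isDiag_of_mem_edgeFinset (hF he)
  rw [← Sym2.card_toFinset_of_not_isDiag e hd]
  congr 1
  ext v
  simp

/-- In a set `F` of edges all of whose endpoints lie in `S`, the edges of `F` at `v` are at most
as many as the neighbours of `v` in `S`. -/
lemma SimpleGraph.card_filter_mem_le_card_inter_neighborFinset {V : Type*} [Fintype V]
    [DecidableEq V] (G : SimpleGraph V) [DecidableRel G.Adj] {F : Finset (Sym2 V)}
    (hF : F ⊆ G.edgeFinset) {S : Finset V} (hS : ∀ e ∈ F, ∀ v ∈ e, v ∈ S) (v : V) :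
    (F.filter (fun e => v ∈ e)).card ≤ (S ∩ G.neighborFinset v).card := by
  classical
  refine (Finset.card_le_card (t := (S ∩ G.neighborFinset v).image (fun u => s(v, u))) ?_).trans
    Finset.card_image_le
  intro e he
  obtain ⟨heF, hve⟩ := Finset.mem_filter.1 he
  obtain ⟨u, rfl⟩ := hve
  have hadj : G.Adj v u := by simpa using hF heF
  exact Finset.mem_image.2
    ⟨u, by simp [hadj, hS _ heF u (Sym2.mem_mk_right v u)], rfl⟩

/-- A string indexed by edges and residual positions, supported on the edges in `T` and on the
residual positions of `D`, has weight between `|T|` and `|T| + 2|D|`. -/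
lemma SimpleGraph.hammingDist_sum_bounds {V : Type*} [Fintype V] [DecidableEq V]
    (G : SimpleGraph V) [DecidableRel G.Adj] {D : Finset (Sym2 V)} (hD : D ⊆ G.edgeFinset)
    {y z : Sym2 V ⊕ V × Sym2 V → ZMod 2}
    (h : ∀ v e, (e ∉ D ∨ v ∉ e) → y (Sum.inr (v, e)) = z (Sum.inr (v, e))) :
    (Finset.univ.filter (fun e => y (Sum.inl e) ≠ z (Sum.inl e))).card ≤ hammingDist y z ∧
    hammingDist y z ≤
      (Finset.univ.filter (fun e => y (Sum.inl e) ≠ z (Sum.inl e))).card + 2 * D.card := by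
  classical
  have hsplit : hammingDist y z
      = (Finset.univ.filter (fun e => y (Sum.inl e) ≠ z (Sum.inl e))).card
        + ∑ v : V, (Finset.univ.filter
            (fun e => y (Sum.inr (v, e)) ≠ z (Sum.inr (v, e)))).card := by
    simp only [hammingDist, Finset.card_filter, Fintype.sum_sum_type, Fintype.sum_prod_type]
  rw [hsplit, ← G.sum_card_filter_mem_eq_two_mul hD]
  refine ⟨Nat.le_add_right _ _, Nat.add_le_add_left (Finset.sum_le_sum fun v _ => ?_) _⟩
  refine Finset.card_le_card fun e he => ?_
  have hne := (Finset.mem_filter.1 he).2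
  refine Finset.mem_filter.2 ⟨?_, ?_⟩ <;> by_contra hc
  · exact hne (h v e (Or.inl hc))
  · exact hne (h v e (Or.inr hc))

/-- The mixing inequality for a set of `s` vertices, `q` of which carry at least `Δ` edges each,
forces `s` to be either small or large. -/
lemma small_or_large_of_mixing {d n s q m E Δ lam ε : ℝ} (hd : 1 ≤ d) (hn : 0 < n)
    (hs : 0 ≤ s) (hE : 2 * E = n * d) (hm : m = ε * E) (hΔ : 0 < Δ)
    (hlam : 4 * lam ≤ Δ) (hε : 300 * d ^ 2 * ε ≤ Δ)
    (hq : s ≤ q + 2 * m) (hmix : Δ * q ≤ d * s ^ 2 / n + lam * s) :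
    s ≤ 2 * d * ε * n ∨ n * Δ ≤ 2 * d * s := by
  by_contra! hc
  obtain ⟨h1, h2⟩ := hc
  have h2m : 2 * m = ε * n * d := by rw [hm]; linear_combination ε * hE
  rw [h2m] at hq
  have hq' : Δ * (s - ε * n * d) ≤ d * s ^ 2 / n + Δ / 4 * s := by
    have := mul_le_mul_of_nonneg_left (show s - ε * n * d ≤ q by linarith) hΔ.le
    have := mul_le_mul_of_nonneg_right (show lam ≤ Δ / 4 by linarith) hs
    linarith
  have hQ : Δ * (s - ε * n * d) * n ≤ d * s ^ 2 + Δ / 4 * s * n := by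
    have := mul_le_mul_of_nonneg_right hq' hn.le
    have h3 : (d * s ^ 2 / n + Δ / 4 * s) * n = d * s ^ 2 + Δ / 4 * s * n := by
      field_simp
    linarith
  have hprod : 0 < (s - 2 * d * ε * n) * (n * Δ - 2 * d * s) :=
    mul_pos (by linarith) (by linarith)
  have hlin : 0 ≤ (Δ - 8 * d ^ 2 * ε) * (s * n) :=
    mul_nonneg (by linarith) (by positivity)
  nlinarith

/-- If few vertices (`s`) are touched by nonzero edges, then the weight `w` is small. -/
lemma weight_le_of_card_le {d s m E t w ε : ℝ} (hd : 1 ≤ d) (hm0 : 0 ≤ m) (hε0 : 0 ≤ ε)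
    (hm : m = ε * E) (htd : 2 * t ≤ s * d) (hw : w ≤ t + 2 * m) (hs : s ≤ 4 * m) :
    w ≤ 10 * d ^ 2 * ε * (E - m + 2 * m) := by
  have h1 : s * d ≤ 4 * m * d := by gcongr
  have h3 : m ≤ m * d := le_mul_of_one_le_right hm0 hd
  have h4 : m * d ≤ m * d * d := le_mul_of_one_le_right (by positivity) hd
  have h5 : 0 ≤ 10 * d ^ 2 * ε * m := by positivity
  have h6 : 10 * d ^ 2 * ε * (E - m + 2 * m) = 10 * (m * d * d) + 10 * d ^ 2 * ε * m := by
    linear_combination (-10 * d ^ 2) * hm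
  have h7 : 0 ≤ m * d := by positivity
  linarith

/-- The numerical form of the distance dichotomy, for a string of weight `w` with `t` nonzero
edges, which touch `s` vertices; `q` of these vertices satisfy their local check. -/
lemma weight_dichotomy {d n s q m E t w Δ lam ε : ℝ} (hd : 1 ≤ d) (hn : 0 < n)
    (hs : 0 ≤ s) (hm0 : 0 ≤ m) (hmE : m ≤ E) (hε0 : 0 ≤ ε) (hE : 2 * E = n * d)
    (hm : m = ε * E) (hΔ : 0 < Δ) (hΔd : Δ ≤ d) (hlam : 4 * lam ≤ Δ)
    (hε : ε ≤ Δ ^ 2 / (300 * d ^ 4)) (hq : s ≤ q + 2 * m) (hΔq : Δ * q ≤ 2 * t)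
    (hmix : 2 * t ≤ d * s ^ 2 / n + lam * s) (htd : 2 * t ≤ s * d) (htw : t ≤ w)
    (hwt : w ≤ t + 2 * m) :
    w ≤ 10 * d ^ 2 * ε * (E - m + 2 * m) ∨ w ≥ Δ ^ 2 / (10 * d ^ 2) * (E - m + 2 * m) := by
  have hεd : 300 * d ^ 2 * ε ≤ Δ := by
    rw [le_div_iff₀ (by positivity)] at hε
    have h1 : Δ ^ 2 ≤ Δ * d ^ 2 := by
      rw [pow_two]
      gcongr
      nlinarith
    refine le_of_mul_le_mul_right (a := d ^ 2) ?_ (by positivity)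
    linarith
  rcases small_or_large_of_mixing hd hn hs hE hm hΔ hlam hεd hq (hΔq.trans hmix) with hs | hs
  · left
    refine weight_le_of_card_le hd hm0 hε0 hm htd hwt (hs.trans (le_of_eq ?_))
    linear_combination (-4) * hm - 2 * ε * hE
  · right
    rw [ge_iff_le, div_mul_eq_mul_div, div_le_iff₀ (by positivity)]
    have h2m : 2 * m = ε * n * d := by linear_combination 2 * hm + ε * hE
    have hEm : E - m + 2 * m ≤ n * d := by linarith
    have hw : Δ * (s - ε * n * d) ≤ 2 * w := by
      have := mul_le_mul_of_nonneg_left (show s - ε * n * d ≤ q by linarith) hΔ.le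
      linarith
    have h1 := mul_le_mul_of_nonneg_left hEm (sq_nonneg Δ)
    have h2 := mul_le_mul_of_nonneg_left hw (show 0 ≤ 5 * d ^ 2 by positivity)
    have h3 := mul_le_mul_of_nonneg_left hs (show 0 ≤ Δ * d by positivity)
    have h4 := mul_le_mul_of_nonneg_left hεd (show 0 ≤ Δ * d * n by positivity)
    have h5 : 0 ≤ Δ ^ 2 * (n * d) := by positivity
    linarith


/-- with a fraction `ε = |E_del|/|E| ≤ Δ₀²/(300d⁴)` of edges deleted,
`λ`-mixing and `Δ₀ ≥ 4λ`, any two strings `y, z ∈ X ⊆ 𝔽₂^{E₁ ∪ R}` (satisfying the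
local checks at every vertex not touching a deleted edge) are at Hamming distance
either `≤ 10d²ε(|E₁| + |R|)` or `≥ (Δ₀²/(10d²))(|E₁| + |R|)`.
Strings over `E₁ ∪ R` are encoded as functions on `Sym2 V ⊕ V × Sym2 V` (edge
positions ⊕ residual positions) vanishing outside `E₁ ∪ R`. -/
theorem deleted_edges_distance_dichotomy {V : Type} [Fintype V] [DecidableEq V]
    (G : SimpleGraph V) [DecidableRel G.Adj]
    (d n k₀ Δ₀ : ℕ) (lam ε : ℝ) (hlam : 0 ≤ lam)
    (hn : Fintype.card V = n)
    (hreg : G.IsRegularOfDegree d)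
    (C : Submodule (ZMod 2) (Fin d → ZMod 2))
    (hk₀ : Module.finrank (ZMod 2) C = k₀)
    (hC : ∀ c ∈ C, c ≠ 0 → Δ₀ ≤ hammingNorm c)
    (hΔ : (Δ₀ : ℝ) ≥ 4 * lam)
    (ν : V → Fin d → Sym2 V)
    (hν : ∀ v : V, Set.range (ν v) = G.incidenceSet v ∧ Function.Injective (ν v))
    (hmix : ∀ S : Finset V,
      (∑ v ∈ S, (S ∩ G.neighborFinset v).card : ℝ)
        ≤ d * (S.card : ℝ) ^ 2 / n + lam * S.card)
    (Edel : Finset (Sym2 V)) (hEdel : Edel ⊆ G.edgeFinset)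
    (hε : ε = (Edel.card : ℝ) / G.edgeFinset.card)
    (hεΔ : ε ≤ (Δ₀ : ℝ) ^ 2 / (300 * d ^ 4))
    (y z : Sym2 V ⊕ V × Sym2 V → ZMod 2)
    -- `y, z ∈ X`: support contained in `E₁ ∪ R` …
    (hy0 : ∀ e : Sym2 V, (e ∉ G.edgeSet ∨ e ∈ Edel) → y (Sum.inl e) = 0)
    (hyR : ∀ (v : V) (e : Sym2 V), (e ∉ Edel ∨ v ∉ e) → y (Sum.inr (v, e)) = 0)
    (hz0 : ∀ e : Sym2 V, (e ∉ G.edgeSet ∨ e ∈ Edel) → z (Sum.inl e) = 0)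
    (hzR : ∀ (v : V) (e : Sym2 V), (e ∉ Edel ∨ v ∉ e) → z (Sum.inr (v, e)) = 0)
    -- … and the local checks hold at every vertex `v ∉ W`, i.e. at every vertex not
    -- incident to a deleted edge (all of whose incident edges lie in `E₁`)
    (hyT : ∀ v : V, ¬(∃ e ∈ Edel, v ∈ e) → (fun i => y (Sum.inl (ν v i))) ∈ C)
    (hzT : ∀ v : V, ¬(∃ e ∈ Edel, v ∈ e) → (fun i => z (Sum.inl (ν v i))) ∈ C) :
    (hammingDist y z : ℝ)
        ≤ 10 * d ^ 2 * ε * ((G.edgeFinset \ Edel).card + 2 * Edel.card)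
      ∨ (hammingDist y z : ℝ)
        ≥ (Δ₀ : ℝ) ^ 2 / (10 * d ^ 2)
            * ((G.edgeFinset \ Edel).card + 2 * Edel.card) := by
  classical
  set T : Finset (Sym2 V) := Finset.univ.filter (fun e => y (Sum.inl e) ≠ z (Sum.inl e)) with hT
  set S : Finset V := Finset.univ.filter (fun v => ∃ e ∈ T, v ∈ e) with hS
  set W : Finset V := Finset.univ.filter (fun v => ∃ e ∈ Edel, v ∈ e) with hW
  have hTE : T ⊆ G.edgeFinset := by
    intro e he
    by_contra hc
    rw [SimpleGraph.mem_edgeFinset] at hc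
    exact (Finset.mem_filter.1 he).2 ((hy0 e (Or.inl hc)).trans (hz0 e (Or.inl hc)).symm)
  obtain ⟨hTw, hwT⟩ := G.hammingDist_sum_bounds hEdel (y := y) (z := z)
    (fun v e h => (hyR v e h).trans (hzR v e h).symm)
  rw [← hT] at hTw hwT
  have hTS : ∀ e ∈ T, ∀ v ∈ e, v ∈ S := fun e he v hv => by
    simpa [hS] using ⟨e, he, hv⟩
  have hdegT := G.card_filter_mem_le_card_inter_neighborFinset hTE hTS
  have h2T : ∑ v ∈ S, (T.filter (fun e => v ∈ e)).card = 2 * T.card := by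
    rw [← G.sum_card_filter_mem_eq_two_mul hTE]
    refine Finset.sum_subset (Finset.subset_univ _) fun v _ hv => ?_
    rw [Finset.card_eq_zero, Finset.filter_eq_empty_iff]
    exact fun e he hve => hv (hTS e he v hve)
  have hTd : 2 * T.card ≤ S.card * d := by
    rw [← h2T, ← smul_eq_mul, ← Finset.sum_const]
    refine Finset.sum_le_sum fun v _ => (hdegT v).trans ?_
    rw [← hreg v, ← G.card_neighborFinset_eq_degree]
    exact Finset.card_le_card Finset.inter_subset_right
  have hlocal : ∀ v ∈ S \ W, Δ₀ ≤ (T.filter (fun e => v ∈ e)).card ∧ Δ₀ ≤ d := by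
    intro v hv
    obtain ⟨hvS, hvW⟩ := Finset.mem_sdiff.1 hv
    have hvW' : ¬ ∃ e ∈ Edel, v ∈ e := by simpa [hW] using hvW
    obtain ⟨e, heT, hve⟩ := (Finset.mem_filter.1 hvS).2
    have hmem := C.sub_mem (hyT v hvW') (hzT v hvW')
    have hinc : e ∈ Set.range (ν v) := by
      rw [(hν v).1]
      exact ⟨SimpleGraph.mem_edgeFinset.1 (hTE heT), hve⟩
    obtain ⟨i, rfl⟩ := hinc
    have hne := (Finset.mem_filter.1 heT).2
    have hle := hC _ hmem (fun h0 => hne (sub_eq_zero.1 (congrFun h0 i)))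
    refine ⟨hle.trans ?_, hle.trans (hammingNorm_le_card_fintype.trans (by simp))⟩
    rw [hammingNorm, ← Finset.card_image_of_injective _ (hν v).2]
    refine Finset.card_le_card fun e he => ?_
    obtain ⟨j, hj, rfl⟩ := Finset.mem_image.1 he
    have hj' := (Finset.mem_filter.1 hj).2
    have hvj : ν v j ∈ G.incidenceSet v := (hν v).1 ▸ Set.mem_range_self j
    exact Finset.mem_filter.2 ⟨Finset.mem_filter.2 ⟨Finset.mem_univ _, sub_ne_zero.1 hj'⟩, hvj.2⟩
  have hΔq : Δ₀ * (S \ W).card ≤ 2 * T.card := by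
    rw [← h2T, mul_comm, ← smul_eq_mul, ← Finset.sum_const]
    exact (Finset.sum_le_sum fun v hv => (hlocal v hv).1).trans
      (Finset.sum_le_sum_of_subset Finset.sdiff_subset)
  have hWm : W.card ≤ 2 * Edel.card := by
    rw [← G.sum_card_filter_mem_eq_two_mul hEdel, Finset.card_filter]
    refine Finset.sum_le_sum fun v _ => ?_
    split_ifs with h
    · obtain ⟨e, he, hve⟩ := h
      exact Finset.card_pos.2 ⟨e, Finset.mem_filter.2 ⟨he, hve⟩⟩
    · exact Nat.zero_le _
  have hsq : S.card ≤ (S \ W).card + 2 * Edel.card :=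
    (Finset.card_le_card_sdiff_add_card (s := S) (t := W)).trans (by omega)
  have hTmix : (2 * T.card : ℝ) ≤ d * (S.card : ℝ) ^ 2 / n + lam * S.card := by
    refine le_trans ?_ (hmix S)
    exact_mod_cast h2T ▸ Finset.sum_le_sum fun v _ => hdegT v
  have hnd : 2 * G.edgeFinset.card = n * d := by
    rw [← G.sum_degrees_eq_twice_card_edges, Finset.sum_congr rfl fun v _ => hreg v]
    simp [hn]
  have hmE := Finset.card_le_card hEdel
  have hcard : ((G.edgeFinset \ Edel).card : ℝ) = G.edgeFinset.card - Edel.card := by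
    rw [Finset.card_sdiff_of_subset hEdel, Nat.cast_sub hmE]
  rw [hcard]
  have hTE' := Finset.card_le_card hTE
  rcases Nat.eq_zero_or_pos G.edgeFinset.card with hE0 | hEpos
  · left
    have : hammingDist y z = 0 := by omega
    have hm0 : Edel.card = 0 := by omega
    simp [this, hE0, hm0]
  have hndpos : 0 < n * d := by omega
  have hnR : (0 : ℝ) < n := by exact_mod_cast Nat.pos_of_mul_pos_right hndpos
  have hdR : (1 : ℝ) ≤ d := by exact_mod_cast Nat.pos_of_mul_pos_left hndpos
  have hER : (0 : ℝ) < G.edgeFinset.card := by exact_mod_cast hEpos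
  have hm : (Edel.card : ℝ) = ε * G.edgeFinset.card := by rw [hε]; field_simp
  have hε0 : 0 ≤ ε := hε ▸ div_nonneg (Nat.cast_nonneg _) hER.le
  have hm0 : (0 : ℝ) ≤ Edel.card := Nat.cast_nonneg _
  rify at hTw hwT hTd hΔq hsq hnd
  rcases (S \ W).eq_empty_or_nonempty with hSW | ⟨v, hv⟩
  · left
    refine weight_le_of_card_le hdR hm0 hε0 hm hTd hwT ?_
    rw [hSW, Finset.card_empty, Nat.cast_zero] at hsq
    linarith
  rcases Nat.eq_zero_or_pos Δ₀ with hΔ0 | hΔpos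
  · right
    simp [hΔ0]
  exact weight_dichotomy hdR hnR (Nat.cast_nonneg _) hm0 (by exact_mod_cast hmE) hε0 hnd hm
    (by exact_mod_cast hΔpos) (by exact_mod_cast (hlocal v hv).2) hΔ hεΔ hsq hΔq hTmix hTd hTw hwT
end

section
/- Suppose ε := |E_del|/|E| satisfies ε ≤ Δ₀²/(300d⁴), G satisfies λ-mixing, and the minimum distance Δ₀ of C satisfies Δ₀ ≥ 4λ. Then X can be partitioned into disjoint nonempty sets B₁, B₂, … such that: (i) any two elements of the same B_i are at Hamming distance at most 10d²ε·(|E₁| + |R|), and (ii) any two elements lying in distinct sets B_i, B_j (i ≠ j) are at Hamming distance at least (Δ₀²/(10d²))·(|E₁| + |R|). -/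
/-- A set of words whose pairwise distances avoid the gap between `a` and `max b (2a)` splits into
clusters of diameter at most `a` that are at distance at least `b` from each other. -/
theorem exists_clustering_of_distance_gap {α : Type} [Fintype α] (X : Set (α → ZMod 2))
    (a b : ℝ) (ha : 0 ≤ a)
    (h : ∀ y ∈ X, ∀ z ∈ X, (hammingDist y z : ℝ) ≤ a ∨
      (b ≤ hammingDist y z ∧ 2 * a < hammingDist y z)) :
    ∃ (ι : Type) (B : ι → Set (α → ZMod 2)),
      (∀ i, (B i).Nonempty) ∧
      (∀ i j, i ≠ j → Disjoint (B i) (B j)) ∧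
      (⋃ i, B i) = X ∧
      (∀ i, ∀ y ∈ B i, ∀ z ∈ B i, (hammingDist y z : ℝ) ≤ a) ∧
      (∀ i j, i ≠ j → ∀ y ∈ B i, ∀ z ∈ B j, (hammingDist y z : ℝ) ≥ b) := by
  let s : Setoid X :=
    { r := fun y z => (hammingDist y.1 z.1 : ℝ) ≤ a
      iseqv :=
        { refl := fun y => by simpa using ha
          symm := fun {y z} hyz => by rwa [hammingDist_comm]
          trans := fun {x y z} hxy hyz => by
            rcases h x.1 x.2 z.1 z.2 with hxz | ⟨-, hxz⟩
            · exact hxz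
            · have : (hammingDist x.1 z.1 : ℝ) ≤ hammingDist x.1 y.1 + hammingDist y.1 z.1 := by
                exact_mod_cast hammingDist_triangle x.1 y.1 z.1
              linarith } }
  refine ⟨Quotient s, fun q => {y | ∃ hy : y ∈ X, Quotient.mk s ⟨y, hy⟩ = q}, ?_, ?_, ?_, ?_, ?_⟩
  · intro q
    induction q using Quotient.ind with
    | _ y => exact ⟨y.1, y.2, rfl⟩
  · intro i j hij
    rw [Set.disjoint_left]
    rintro y ⟨hy, rfl⟩ ⟨_, h'⟩
    exact hij h'
  · ext y
    simp
  · rintro _ y ⟨hy, rfl⟩ z ⟨hz, hzy⟩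
    have hyz : s ⟨y, hy⟩ ⟨z, hz⟩ := Quotient.exact hzy.symm
    exact hyz
  · rintro _ _ hij y ⟨hy, rfl⟩ z ⟨hz, rfl⟩
    rcases h y hy z hz with hyz | ⟨hyz, -⟩
    · have hs : s ⟨y, hy⟩ ⟨z, hz⟩ := hyz
      exact absurd (Quotient.sound hs) hij
    · exact hyz

/-- If `K (t - p) ≤ d t² + K t / 4` with `p` small, then `t` is at most about `p` or at least
about `K / d`. -/
theorem le_or_le_of_mixing_quadratic {K d p t : ℝ} (ht : 0 ≤ t)
    (hp : 8 * p * d ≤ K) (h : K * (t - p) ≤ d * t ^ 2 + K * t / 4) :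
    t ≤ 2 * p ∨ K ≤ 2 * d * t := by
  by_contra! hc
  have h1 := mul_pos (sub_pos.2 hc.1) (sub_pos.2 hc.2)
  have h2 := mul_nonneg (sub_nonneg.2 hp) ht
  nlinarith

/-- The numerical gap argument: `M` edges of which `m` are deleted, `t` active vertices of which
`w` touch deleted edges, and `x` the weight of the word. -/
theorem weight_gap {n d Δ m M t w x lam : ℝ} (hn : 0 < n) (hd : 1 ≤ d) (hM : n * d = 2 * M)
    (hm : 0 ≤ m) (hΔ : 0 ≤ Δ) (hx : 0 ≤ x) (ht : 0 ≤ t)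
    (hlam : 4 * lam ≤ Δ) (hε : m / M ≤ Δ ^ 2 / (300 * d ^ 4)) (hw : w ≤ 2 * m)
    (hup : x ≤ d * t + 2 * m) (hlow : Δ * (t - w) ≤ 2 * x)
    (hmix : Δ * (t - w) ≤ d * t ^ 2 / n + lam * t) (hcase : t = w ∨ Δ ≤ d) :
    x ≤ 10 * d ^ 2 * (m / M) * (M + m) ∨
      (Δ ^ 2 / (10 * d ^ 2) * (M + m) ≤ x ∧ 2 * (10 * d ^ 2 * (m / M) * (M + m)) < x) := by
  have hd0 : 0 < d := by linarith
  have hM0 : 0 < M := by nlinarith [mul_pos hn hd0]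
  have ha : 10 * d ^ 2 * m ≤ 10 * d ^ 2 * (m / M) * (M + m) := by
    have h1 : 10 * d ^ 2 * (m / M) * (M + m) = 10 * d ^ 2 * m + 10 * d ^ 2 * (m / M) * m := by
      field_simp
    rw [h1]
    have : 0 ≤ 10 * d ^ 2 * (m / M) * m := by positivity
    linarith
  have hsmall : t ≤ 4 * m → x ≤ 10 * d ^ 2 * (m / M) * (M + m) := by
    intro h
    refine le_trans ?_ ha
    have h1 : d * t ≤ d * (4 * m) := mul_le_mul_of_nonneg_left h hd0.le
    have h2 : 0 ≤ (d - 1) * (d * m) := mul_nonneg (by linarith) (by positivity)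
    have h3 : 0 ≤ (d - 1) * m := mul_nonneg (by linarith) hm
    nlinarith
  rcases hcase with rfl | hΔd
  · exact Or.inl (hsmall (by linarith))
  rcases hΔ.eq_or_lt with rfl | hΔ0
  · have hm0 : m / M = 0 := le_antisymm (by simpa using hε) (by positivity)
    rcases hx.eq_or_lt with rfl | hx0
    · left; simp [hm0]
    · right; simp [hm0, hx0, hx0.le]
  rw [div_le_div_iff₀ hM0 (by positivity)] at hε
  have hdp : 300 * d ^ 3 * (2 * m) ≤ Δ ^ 2 * n := by
    have : d * (300 * d ^ 3 * (2 * m)) ≤ d * (Δ ^ 2 * n) := by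
      have : Δ ^ 2 * (n * d) = Δ ^ 2 * (2 * M) := by rw [hM]
      nlinarith
    exact le_of_mul_le_mul_left this hd0
  have hΔdd : Δ ≤ d ^ 2 := by nlinarith
  have hp : 300 * d * (2 * m) ≤ Δ * n := by
    have h1 : Δ ^ 2 * n ≤ d ^ 2 * (Δ * n) := by
      have := mul_nonneg (sub_nonneg.2 hΔdd) (mul_pos hΔ0 hn).le
      nlinarith
    have : d ^ 2 * (300 * d * (2 * m)) ≤ d ^ 2 * (Δ * n) := by nlinarith
    exact le_of_mul_le_mul_left this (by positivity)
  have hw' : Δ * (t - 2 * m) ≤ Δ * (t - w) := mul_le_mul_of_nonneg_left (by linarith) hΔ0.le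
  have hq : Δ * n * (t - 2 * m) ≤ d * t ^ 2 + Δ * n * t / 4 := by
    have h1 : Δ * (t - 2 * m) ≤ d * t ^ 2 / n + Δ / 4 * t := by
      have : lam * t ≤ Δ / 4 * t := mul_le_mul_of_nonneg_right (by linarith) ht
      linarith
    have h2 := mul_le_mul_of_nonneg_left h1 hn.le
    have h3 : n * (d * t ^ 2 / n + Δ / 4 * t) = d * t ^ 2 + Δ * n * t / 4 := by
      field_simp
    linarith
  rcases le_or_le_of_mixing_quadratic ht
    (by have : 0 ≤ d * m := by positivity
        nlinarith) hq with h | h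
  · exact Or.inl (hsmall (by linarith))
  right
  have hxl : Δ ^ 2 * n * (298 / 300) ≤ 4 * d * x := by
    have h1 : 2 * d * (Δ * (t - 2 * m)) ≤ 2 * d * (2 * x) :=
      mul_le_mul_of_nonneg_left (by linarith) (by positivity)
    have h2 : Δ * (Δ * n) ≤ Δ * (2 * d * t) := mul_le_mul_of_nonneg_left h hΔ0.le
    have h3 : Δ * (300 * d * (2 * m)) ≤ Δ * (Δ * n) := mul_le_mul_of_nonneg_left hp hΔ0.le
    nlinarith
  have hmM : 300 * m ≤ M := by
    have h1 : d * (300 * m) ≤ d * M := by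
      have : Δ * n ≤ d * n := mul_le_mul_of_nonneg_right hΔd hn.le
      nlinarith
    exact le_of_mul_le_mul_left h1 hd0
  have hb0 : 0 < Δ ^ 2 / (10 * d ^ 2) * (M + m) := by positivity
  have hb : Δ ^ 2 / (10 * d ^ 2) * (M + m) ≤ x := by
    rw [div_mul_eq_mul_div, div_le_iff₀ (by positivity)]
    have h1 : Δ ^ 2 * (M + m) ≤ Δ ^ 2 * (n * d * (301 / 600)) :=
      mul_le_mul_of_nonneg_left (by linarith) (by positivity)
    have h2 := mul_le_mul_of_nonneg_left hxl hd0.le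
    have h3 : 0 ≤ Δ ^ 2 * n * d := by positivity
    nlinarith
  have hab : 3 * (10 * d ^ 2 * (m / M) * (M + m)) ≤ Δ ^ 2 / (10 * d ^ 2) * (M + m) := by
    rw [← mul_assoc]
    refine mul_le_mul_of_nonneg_right ?_ (by linarith)
    rw [le_div_iff₀ (by positivity)]
    have h1 : 3 * (10 * d ^ 2 * (m / M)) * (10 * d ^ 2) = m * (300 * d ^ 4) / M := by
      field_simp; ring
    rw [h1, div_le_iff₀ hM0]
    exact hε
  exact ⟨hb, by linarith⟩

theorem Sym2.card_filter_mem_le_two {V : Type*} [Fintype V] [DecidableEq V] (e : Sym2 V) :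
    (Finset.univ.filter (· ∈ e)).card ≤ 2 := by
  induction e with
  | _ a b =>
    refine (Finset.card_le_card fun v hv => ?_).trans (Finset.card_le_two (a := a) (b := b))
    simpa using hv

/-- For a word `x` satisfying the local checks away from deleted edges, the set of vertices
touching a deleted edge (of size `w`) or the support of `x` (of total size `t`). -/
theorem exists_active_vertex_counts {V : Type} [Fintype V] [DecidableEq V]
    (G : SimpleGraph V) [DecidableRel G.Adj]
    (d n Δ₀ : ℕ) (lam : ℝ)
    (hn : Fintype.card V = n)
    (C : Submodule (ZMod 2) (Fin d → ZMod 2))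
    (hC : ∀ c ∈ C, c ≠ 0 → Δ₀ ≤ hammingNorm c)
    (ν : V → Fin d → Sym2 V)
    (hν : ∀ v : V, Set.range (ν v) = G.incidenceSet v ∧ Function.Injective (ν v))
    (hmix : ∀ S : Finset V,
      (∑ v ∈ S, (S ∩ G.neighborFinset v).card : ℝ)
        ≤ d * (S.card : ℝ) ^ 2 / n + lam * S.card)
    (Edel : Finset (Sym2 V)) (x : Sym2 V ⊕ V × Sym2 V → ZMod 2)
    (hx1 : ∀ e : Sym2 V, (e ∉ G.edgeSet ∨ e ∈ Edel) → x (Sum.inl e) = 0)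
    (hx2 : ∀ (v : V) (e : Sym2 V), (e ∉ Edel ∨ v ∉ e) → x (Sum.inr (v, e)) = 0)
    (hx3 : ∀ v : V, ¬(∃ e ∈ Edel, v ∈ e) → (fun i => x (Sum.inl (ν v i))) ∈ C) :
    ∃ t w : ℕ, t ≤ n ∧ w ≤ 2 * Edel.card ∧
      hammingNorm x ≤ d * t + 2 * Edel.card ∧
      (Δ₀ * ((t : ℝ) - w) ≤ 2 * hammingNorm x) ∧
      (Δ₀ * ((t : ℝ) - w) ≤ d * (t : ℝ) ^ 2 / n + lam * t) ∧
      (t = w ∨ Δ₀ ≤ d) := by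
  classical
  let F : Finset (Sym2 V) := Finset.univ.filter fun e => x (Sum.inl e) ≠ 0
  let R : Finset (V × Sym2 V) := Finset.univ.filter fun p => x (Sum.inr p) ≠ 0
  let W : Finset V := Finset.univ.filter fun v => ∃ e ∈ Edel, v ∈ e
  let T : Finset V := Finset.univ.filter fun v => v ∈ W ∨ ∃ e ∈ F, v ∈ e
  let D : V → Finset (Sym2 V) := fun v => F.filter fun e => v ∈ e
  have hFG : ∀ e ∈ F, e ∈ G.edgeSet := fun e he => by
    by_contra h
    exact (Finset.mem_filter.1 he).2 (hx1 e (Or.inl h))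
  have hWT : W ⊆ T := fun v hv => Finset.mem_filter.2 ⟨Finset.mem_univ _, Or.inl hv⟩
  have hnorm : hammingNorm x = F.card + R.card := by
    have : (Finset.univ.filter fun p => x p ≠ 0) = F.disjSum R := by
      ext p
      rcases p with e | p <;> simp [F, R]
    rw [hammingNorm, this, Finset.card_disjSum]
  have hDν : ∀ v, D v = (Finset.univ.filter fun i => x (Sum.inl (ν v i)) ≠ 0).image (ν v) := by
    intro v
    ext e
    simp only [D, Finset.mem_filter, Finset.mem_image, Finset.mem_univ, true_and]
    constructor
    · rintro ⟨he, hve⟩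
      have : e ∈ Set.range (ν v) := by
        rw [(hν v).1]
        exact ⟨hFG e he, hve⟩
      obtain ⟨i, rfl⟩ := this
      exact ⟨i, (Finset.mem_filter.1 he).2, rfl⟩
    · rintro ⟨i, hi, rfl⟩
      have : ν v i ∈ G.incidenceSet v := (hν v).1 ▸ Set.mem_range_self i
      exact ⟨Finset.mem_filter.2 ⟨Finset.mem_univ _, hi⟩, this.2⟩
  have hDcard : ∀ v, (D v).card = hammingNorm fun i => x (Sum.inl (ν v i)) := by
    intro v
    rw [hDν, Finset.card_image_of_injective _ (hν v).2, hammingNorm]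
  have hDd : ∀ v, (D v).card ≤ d := fun v => by
    rw [hDcard]
    simpa using hammingNorm_le_card_fintype (x := fun i => x (Sum.inl (ν v i)))
  have hDΔ : ∀ v ∈ T \ W, Δ₀ ≤ (D v).card := by
    intro v hv
    obtain ⟨hvT, hvW⟩ := Finset.mem_sdiff.1 hv
    obtain ⟨e, he, hve⟩ := (Finset.mem_filter.1 hvT).2.resolve_left hvW
    have hvW' : ¬ ∃ e ∈ Edel, v ∈ e := fun h => hvW (Finset.mem_filter.2 ⟨Finset.mem_univ _, h⟩)
    rw [hDcard]
    refine hC _ (hx3 v hvW') fun h0 => ?_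
    have hcard := hDcard v
    rw [h0, hammingNorm_zero, Finset.card_eq_zero] at hcard
    exact Finset.notMem_empty e (hcard ▸ Finset.mem_filter.2 ⟨he, hve⟩)
  have hDN : ∀ v, (D v).card ≤ (T ∩ G.neighborFinset v).card := by
    intro v
    refine (Finset.card_le_card (t := (T ∩ G.neighborFinset v).image fun u => s(v, u)) ?_).trans
      Finset.card_image_le
    intro e he
    obtain ⟨heF, hve⟩ := Finset.mem_filter.1 he
    obtain ⟨u, rfl⟩ := Sym2.mem_iff_exists.1 hve
    refine Finset.mem_image.2 ⟨u, Finset.mem_inter.2 ⟨Finset.mem_filter.2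
      ⟨Finset.mem_univ _, Or.inr ⟨_, heF, Sym2.mem_mk_right v u⟩⟩, ?_⟩, rfl⟩
    simpa using hFG _ heF
  have hsumΔ : Δ₀ * (T \ W).card ≤ ∑ v ∈ T \ W, (D v).card := by
    rw [mul_comm, ← smul_eq_mul]
    exact Finset.card_nsmul_le_sum _ _ _ hDΔ
  have hsumF : ∑ v, (D v).card ≤ 2 * F.card := by
    have := Finset.sum_card_bipartiteAbove_eq_sum_card_bipartiteBelow
      (s := (Finset.univ : Finset V)) (t := F) (fun v e => v ∈ e)
    calc ∑ v, (D v).card = ∑ e ∈ F, (Finset.univ.filter (· ∈ e)).card := this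
      _ ≤ F.card • 2 := Finset.sum_le_card_nsmul _ _ _ fun e _ => Sym2.card_filter_mem_le_two e
      _ = 2 * F.card := by rw [smul_eq_mul, mul_comm]
  have hcast : ((T \ W).card : ℝ) = (T.card : ℝ) - W.card := by
    rw [Finset.card_sdiff_of_subset hWT, Nat.cast_sub (Finset.card_le_card hWT)]
  refine ⟨T.card, W.card, hn ▸ Finset.card_le_univ T, ?_, ?_, ?_, ?_, ?_⟩
  · calc W.card ≤ (Edel.biUnion fun e => Finset.univ.filter (· ∈ e)).card :=
          Finset.card_le_card fun v hv => by simpa [W] using hv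
      _ ≤ Edel.card * 2 := Finset.card_biUnion_le_card_mul _ _ _ fun e _ =>
          Sym2.card_filter_mem_le_two e
      _ = 2 * Edel.card := mul_comm _ _
  · rw [hnorm]
    refine add_le_add ?_ ?_
    · calc F.card ≤ (T.biUnion D).card := Finset.card_le_card fun e he => by
            obtain ⟨v, hv⟩ : ∃ v, v ∈ e := ⟨_, Sym2.out_fst_mem e⟩
            exact Finset.mem_biUnion.2 ⟨v, Finset.mem_filter.2
              ⟨Finset.mem_univ _, Or.inr ⟨e, he, hv⟩⟩, Finset.mem_filter.2 ⟨he, hv⟩⟩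
        _ ≤ T.card * d := Finset.card_biUnion_le_card_mul _ _ _ fun v _ => hDd v
        _ = d * T.card := mul_comm _ _
    · calc R.card ≤ (Edel.biUnion fun e =>
              (Finset.univ.filter (· ∈ e)).image fun v => (v, e)).card :=
            Finset.card_le_card fun p hp => by
              obtain ⟨v, e⟩ := p
              have hne := (Finset.mem_filter.1 hp).2
              have : e ∈ Edel ∧ v ∈ e := by
                by_contra h
                exact hne (hx2 v e (by tauto))
              simpa using this
        _ ≤ Edel.card * 2 := Finset.card_biUnion_le_card_mul _ _ _ fun e _ =>
            Finset.card_image_le.trans (Sym2.card_filter_mem_le_two e)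
        _ = 2 * Edel.card := mul_comm _ _
  · rw [← hcast]
    have h1 : ∑ v ∈ T \ W, (D v).card ≤ ∑ v, (D v).card :=
      Finset.sum_le_sum_of_subset (Finset.subset_univ _)
    have : Δ₀ * (T \ W).card ≤ 2 * hammingNorm x := by omega
    exact_mod_cast this
  · rw [← hcast]
    refine le_trans ?_ (hmix T)
    have h1 : ∑ v ∈ T \ W, (D v).card ≤ ∑ v ∈ T, (T ∩ G.neighborFinset v).card :=
      (Finset.sum_le_sum fun v _ => hDN v).trans
        (Finset.sum_le_sum_of_subset Finset.sdiff_subset)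
    exact_mod_cast hsumΔ.trans h1
  · rcases (T \ W).eq_empty_or_nonempty with h | ⟨v, hv⟩
    · left
      rw [Finset.sdiff_eq_empty_iff_subset] at h
      rw [h.antisymm hWT]
    · exact Or.inr ((hDΔ v hv).trans (hDd v))


/-- with a fraction `ε = |E_del|/|E| ≤ Δ₀²/(300d⁴)` of edges deleted,
`λ`-mixing and `Δ₀ ≥ 4λ`, the set `X ⊆ 𝔽₂^{E₁ ∪ R}` of strings satisfying the local
checks at every vertex not touching a deleted edge can be partitioned into nonempty
pieces `B i` of diameter `≤ 10d²ε(|E₁| + |R|)`, with distinct pieces at Hamming distance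
`≥ (Δ₀²/(10d²))(|E₁| + |R|)` from one another.  Strings over `E₁ ∪ R` are encoded as
functions on `Sym2 V ⊕ V × Sym2 V` vanishing outside `E₁ ∪ R`. -/
theorem deleted_edges_clustering {V : Type} [Fintype V] [DecidableEq V]
    (G : SimpleGraph V) [DecidableRel G.Adj]
    (d n k₀ Δ₀ : ℕ) (lam ε : ℝ) (hlam : 0 ≤ lam)
    (hn : Fintype.card V = n)
    (hreg : G.IsRegularOfDegree d)
    (C : Submodule (ZMod 2) (Fin d → ZMod 2))
    (hk₀ : Module.finrank (ZMod 2) C = k₀)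
    (hC : ∀ c ∈ C, c ≠ 0 → Δ₀ ≤ hammingNorm c)
    (hΔ : (Δ₀ : ℝ) ≥ 4 * lam)
    (ν : V → Fin d → Sym2 V)
    (hν : ∀ v : V, Set.range (ν v) = G.incidenceSet v ∧ Function.Injective (ν v))
    (hmix : ∀ S : Finset V,
      (∑ v ∈ S, (S ∩ G.neighborFinset v).card : ℝ)
        ≤ d * (S.card : ℝ) ^ 2 / n + lam * S.card)
    (Edel : Finset (Sym2 V)) (hEdel : Edel ⊆ G.edgeFinset)
    (hε : ε = (Edel.card : ℝ) / G.edgeFinset.card)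
    (hεΔ : ε ≤ (Δ₀ : ℝ) ^ 2 / (300 * d ^ 4))
    (X : Set (Sym2 V ⊕ V × Sym2 V → ZMod 2))
    (hX : ∀ y, y ∈ X ↔
      (∀ e : Sym2 V, (e ∉ G.edgeSet ∨ e ∈ Edel) → y (Sum.inl e) = 0) ∧
      (∀ (v : V) (e : Sym2 V), (e ∉ Edel ∨ v ∉ e) → y (Sum.inr (v, e)) = 0) ∧
      (∀ v : V, ¬(∃ e ∈ Edel, v ∈ e) → (fun i => y (Sum.inl (ν v i))) ∈ C)) :
    ∃ (ι : Type) (B : ι → Set (Sym2 V ⊕ V × Sym2 V → ZMod 2)),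
      (∀ i, (B i).Nonempty) ∧
      (∀ i j, i ≠ j → Disjoint (B i) (B j)) ∧
      (⋃ i, B i) = X ∧
      (∀ i, ∀ y ∈ B i, ∀ z ∈ B i,
        (hammingDist y z : ℝ)
          ≤ 10 * d ^ 2 * ε * ((G.edgeFinset \ Edel).card + 2 * Edel.card)) ∧
      (∀ i j, i ≠ j → ∀ y ∈ B i, ∀ z ∈ B j,
        (hammingDist y z : ℝ)
          ≥ (Δ₀ : ℝ) ^ 2 / (10 * d ^ 2)
              * ((G.edgeFinset \ Edel).card + 2 * Edel.card)) := by

  have hcardE : (n : ℝ) * d = 2 * G.edgeFinset.card := by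
    have := G.sum_degrees_eq_twice_card_edges
    simp only [hreg.degree_eq, Finset.sum_const, Finset.card_univ, hn, smul_eq_mul] at this
    exact_mod_cast this
  have hmM := Finset.card_le_card hEdel
  have hN : (((G.edgeFinset \ Edel).card : ℝ) + 2 * Edel.card) =
      (G.edgeFinset.card : ℝ) + Edel.card := by
    rw [Finset.card_sdiff_of_subset hEdel, Nat.cast_sub hmM]
    ring
  rw [hN]
  refine exists_clustering_of_distance_gap X _ _ (by rw [hε]; positivity) fun y hy z hz => ?_
  obtain ⟨hy1, hy2, hy3⟩ := (hX y).1 hy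
  obtain ⟨hz1, hz2, hz3⟩ := (hX z).1 hz
  obtain ⟨t, w, htn, hw, hup, hlow, hmix', hcase⟩ :=
    exists_active_vertex_counts G d n Δ₀ lam hn C hC ν hν hmix Edel (-y + z)
      (fun e he => by simp [hy1 e he, hz1 e he])
      (fun v e he => by simp [hy2 v e he, hz2 v e he])
      (fun v hv => C.add_mem (C.neg_mem (hy3 v hv)) (hz3 v hv))
  rw [hammingDist_eq_hammingNorm]
  rcases Nat.eq_zero_or_pos (n * d) with h0 | hpos
  · have hE : G.edgeFinset.card = 0 := by
      have : n * d = 2 * G.edgeFinset.card := by exact_mod_cast hcardE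
      omega
    have hdt : d * t = 0 := by
      have := Nat.mul_le_mul_left d htn
      rw [mul_comm n d] at h0
      omega
    have hzero : hammingNorm (-y + z) = 0 := by omega
    left
    rw [hzero, hε]
    simp only [Nat.cast_zero]
    positivity
  · subst hε
    exact weight_gap (lam := lam) (t := t) (w := w)
      (by exact_mod_cast Nat.pos_of_mul_pos_right hpos)
      (by exact_mod_cast Nat.pos_of_mul_pos_left hpos) hcardE (by positivity) (by positivity)
      (by positivity) (by positivity) hΔ hεΔ (by exact_mod_cast hw) (by exact_mod_cast hup)
      hlow hmix' (by exact_mod_cast hcase)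
end

section
/- Fix b ∈ 𝔽₂^R and let W_b := {v ∈ W : there exists c ∈ C agreeing with b on all residual positions (v,e) at v}. Define X_b := {y ∈ 𝔽₂^{E₁} : for every v ∈ (V∖W) ∪ W_b, the local string of the pair (y,b) at v (reading y on incident E₁-edges and b on residual positions at v) lies in C}. If X_b is nonempty, then |X_b| ≥ 2^{(2k₀/d − 1)|E₁| − |R|}. -/
open Module in
/-- Imposing, for each `v` in a finite family, membership of a linear image in a fixed subspace `C`
cuts the dimension by at most the codimension of `C` for each `v`. -/
theorem finrank_le_finrank_ker_pi_mkQ_add {K ι M N : Type*} [Field K] [Fintype ι]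
    [AddCommGroup M] [Module K M] [FiniteDimensional K M]
    [AddCommGroup N] [Module K N] [FiniteDimensional K N]
    (C : Submodule K N) (f : ι → M →ₗ[K] N) :
    finrank K M ≤ finrank K (LinearMap.ker (LinearMap.pi fun v => C.mkQ ∘ₗ f v))
      + Fintype.card ι * (finrank K N - finrank K C) := by
  have h := (LinearMap.pi fun v => C.mkQ ∘ₗ f v).finrank_range_add_finrank_ker
  have hr := Submodule.finrank_le (LinearMap.range (LinearMap.pi fun v => C.mkQ ∘ₗ f v))
  rw [Module.finrank_pi_fintype] at hr
  simp only [Finset.sum_const, Finset.card_univ, smul_eq_mul] at hr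
  rw [← C.finrank_quotient_add_finrank, Nat.add_sub_cancel]
  omega

/-- The exponent comparison behind the count: `m` remaining edges, `D` deleted edges, `n` vertices
of degree `d`, and a solution space of dimension `r`. -/
theorem rate_exponent_le {m D n d k r : ℕ} (hk : k ≤ d) (hE : n * d = 2 * (m + D))
    (hr : m ≤ r + n * (d - k)) :
    (2 * (k : ℝ) / d - 1) * m - 2 * D ≤ r := by
  have hE' : (n : ℝ) * d = 2 * (m + D) := by exact_mod_cast hE
  have hr' : (m : ℝ) ≤ r + n * (d - k) := by
    rw [← Nat.cast_sub hk]
    exact_mod_cast hr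
  have hkm : 2 * (k : ℝ) / d * m ≤ n * k := by
    rcases Nat.eq_zero_or_pos d with rfl | hd
    · simp only [Nat.cast_zero, div_zero, zero_mul]
      positivity
    · have hd' : (0 : ℝ) < d := by exact_mod_cast hd
      rw [div_mul_eq_mul_div, div_le_iff₀ hd']
      have : (0 : ℝ) ≤ k * D := by positivity
      linear_combination 2 * this - (k : ℝ) * hE'
  linarith


/-- fix a residual assignment `b ∈ 𝔽₂^R` and let `W_b ⊆ W` be the set of
vertices of `W` whose local code `C` is consistent with `b` on the residual positions.
If the set `X_b ⊆ 𝔽₂^{E₁}` of strings satisfying the local checks at every vertex of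
`(V ∖ W) ∪ W_b` (reading `b` on residual positions) is nonempty, then
`|X_b| ≥ 2^{(2k₀/d − 1)|E₁| − |R|}`. -/
theorem residual_code_count_lower_bound {V : Type} [Fintype V] [DecidableEq V]
    (G : SimpleGraph V) [DecidableRel G.Adj]
    (d n k₀ : ℕ)
    (hn : Fintype.card V = n)
    (hreg : G.IsRegularOfDegree d)
    (C : Submodule (ZMod 2) (Fin d → ZMod 2))
    (hk₀ : Module.finrank (ZMod 2) C = k₀)
    (ν : V → Fin d → Sym2 V)
    (hν : ∀ v : V, Set.range (ν v) = G.incidenceSet v ∧ Function.Injective (ν v))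
    (Edel : Finset (Sym2 V)) (hEdel : Edel ⊆ G.edgeFinset)
    (b : V × Sym2 V → ZMod 2)
    (Xb : Set (Sym2 V → ZMod 2))
    (hXb : ∀ y, y ∈ Xb ↔
      -- `y ∈ 𝔽₂^{E₁}`: it vanishes outside `E₁ = E ∖ E_del`
      (∀ e : Sym2 V, (e ∉ G.edgeSet ∨ e ∈ Edel) → y e = 0) ∧
      -- the local check of the pair `(y, b)` holds at every `v ∈ (V ∖ W) ∪ W_b`,
      -- i.e. at every `v` that touches no deleted edge or whose local code is
      -- consistent with `b` on the residual positions at `v`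
      (∀ v : V,
        (¬(∃ e ∈ Edel, v ∈ e) ∨
          ∃ c ∈ C, ∀ i : Fin d, ν v i ∈ Edel → c i = b (v, ν v i)) →
        (fun i => if ν v i ∈ Edel then b (v, ν v i) else y (ν v i)) ∈ C))
    (hne : Xb.Nonempty) :
    (Nat.card Xb : ℝ)
      ≥ (2 : ℝ) ^ ((2 * (k₀ : ℝ) / d - 1) * ((G.edgeFinset \ Edel).card : ℝ)
          - 2 * Edel.card) := by
  classical
  subst hk₀
  set E₁ := G.edgeFinset \ Edel with hE₁
  obtain ⟨y₀, hy₀⟩ := hne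
  let ext : (E₁ → ZMod 2) →ₗ[ZMod 2] (Sym2 V → ZMod 2) :=
    Function.ExtendByZero.linearMap (ZMod 2) Subtype.val
  have ext_val : ∀ (z : E₁ → ZMod 2) (e : E₁), ext z e = z e := fun z e =>
    Subtype.val_injective.extend_apply z (0 : Sym2 V → ZMod 2) e
  have ext_zero : ∀ (z : E₁ → ZMod 2) (e : Sym2 V), e ∉ E₁ → ext z e = 0 := fun z e he =>
    Function.extend_apply' z (0 : Sym2 V → ZMod 2) e fun ⟨a, ha⟩ => he (ha ▸ a.2)
  let loc : V → (E₁ → ZMod 2) →ₗ[ZMod 2] (Fin d → ZMod 2) := fun v =>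
    LinearMap.funLeft (ZMod 2) (ZMod 2) (ν v) ∘ₗ ext
  let S := LinearMap.ker (LinearMap.pi fun v => C.mkQ ∘ₗ loc v)
  have hS : ∀ z ∈ S, y₀ + ext z ∈ Xb := by
    intro z hz
    rw [hXb] at hy₀ ⊢
    refine ⟨fun e he => ?_, fun v hv => ?_⟩
    · have : e ∉ E₁ := by
        simp only [hE₁, Finset.mem_sdiff, SimpleGraph.mem_edgeFinset]
        tauto
      simp [hy₀.1 e he, ext_zero z e this]
    · have hzv : loc v z ∈ C := by
        have := congrFun (LinearMap.mem_ker.mp hz) v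
        simpa using this
      convert C.add_mem (hy₀.2 v hv) hzv using 1
      funext i
      have hi : loc v z i = ext z (ν v i) := rfl
      by_cases h : ν v i ∈ Edel
      · have : ν v i ∉ E₁ := fun h' => (Finset.mem_sdiff.mp h').2 h
        simp [h, hi, ext_zero z _ this]
      · simp [h, hi]
  have hcard : Nat.card S ≤ Nat.card Xb := by
    refine Nat.card_le_card_of_injective (fun z : S => (⟨y₀ + ext z, hS z z.2⟩ : Xb)) ?_
    intro z w hzw
    have h := add_left_cancel (congrArg Subtype.val hzw)
    refine Subtype.ext (funext fun e => ?_)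
    rw [← ext_val z.1 e, ← ext_val w.1 e, h]
  have hdim := finrank_le_finrank_ker_pi_mkQ_add C loc
  simp only [Module.finrank_fintype_fun_eq_card, Fintype.card_coe, Fintype.card_fin] at hdim
  have hkd : Module.finrank (ZMod 2) C ≤ d := by
    simpa using C.finrank_le
  have hshake : Fintype.card V * d = 2 * (E₁.card + Edel.card) := by
    rw [hE₁, Finset.card_sdiff_add_card_eq_card hEdel, ← G.sum_degrees_eq_twice_card_edges]
    simp [hreg.degree_eq]
  have hSc : Nat.card S = 2 ^ Module.finrank (ZMod 2) S := by
    rw [Module.natCard_eq_pow_finrank (K := ZMod 2), Nat.card_zmod]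
  calc (2 : ℝ) ^ ((2 * (Module.finrank (ZMod 2) C : ℝ) / d - 1) * (E₁.card : ℝ) - 2 * Edel.card)
      ≤ (2 : ℝ) ^ (Module.finrank (ZMod 2) S : ℝ) :=
        Real.rpow_le_rpow_of_exponent_le one_le_two (rate_exponent_le hkd hshake hdim)
    _ = Nat.card S := by
        rw [hSc, Real.rpow_natCast]
        push_cast
        rfl
    _ ≤ Nat.card Xb := by exact_mod_cast hcard
end
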